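/- The group G_2(ℂ) acts transitively on the complex unit sphere S_ℂ^6 of the imaginary part: for every v ∈ ℂ^8 with zeroth coordinate v_0 = 0 (i.e. v in the ℂ-span of e_1,…,e_7) and (v,v) = 1, there exists g ∈ G_2(ℂ) with g e_1 = v. Hence S_ℂ^6 is identified with the non-symmetric homogeneous space G_2(ℂ)/SL(3,ℂ), where SL(3,ℂ) is realized as the stabilizer of e_1 in G_2(ℂ). -/

import Mathlib

open Matrix

noncomputable section

/-- The standard basis of the complexified Cayley algebra `𝕆_ℂ = ℂ^8`. -/
def e (i : Fin 8) : Fin 8 → ℂ := Pi.single i 1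

/-- The oriented lines of the multiplication table of the Cayley algebra:
`(i, j, k)` in this list means `e_i e_j = e_k`. -/
def octLines : List (Fin 8 × Fin 8 × Fin 8) :=
  [(1,2,3),(2,3,1),(3,1,2),
   (1,4,5),(4,5,1),(5,1,4),
   (1,6,7),(6,7,1),(7,1,6),
   (2,5,7),(5,7,2),(7,2,5),
   (2,6,4),(6,4,2),(4,2,6),
   (3,5,6),(5,6,3),(6,3,5),
   (3,4,7),(4,7,3),(7,3,4)]

/-- Product of two basis elements of the complexified Cayley algebra. -/
def octBasisMul (i j : Fin 8) : Fin 8 → ℂ :=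
  if i = 0 then e j
  else if j = 0 then e i
  else if i = j then -(e 0)
  else
    match octLines.find? (fun t => t.1 == i && t.2.1 == j) with
    | some t => e t.2.2
    | none =>
      match octLines.find? (fun t => t.1 == j && t.2.1 == i) with
      | some t => -(e t.2.2)
      | none => 0

/-- The bilinear multiplication of the complexified Cayley algebra `𝕆_ℂ`. -/
def octMul (x y : Fin 8 → ℂ) : Fin 8 → ℂ :=
  ∑ i, ∑ j, (x i * y j) • octBasisMul i j

/-- The standard symmetric bilinear form on `ℂ^8`. -/
def bform (v w : Fin 8 → ℂ) : ℂ := ∑ i, v i * w i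

/-- `SO(8, ℂ)`. -/
def SO8 (g : Matrix (Fin 8) (Fin 8) ℂ) : Prop := gᵀ * g = 1 ∧ g.det = 1

/-- A matrix has real entries. -/
def realMat (g : Matrix (Fin 8) (Fin 8) ℂ) : Prop := ∀ i j, (g i j).im = 0

/-- The realization of `G₂(ℂ)` as automorphisms of `𝕆_ℂ`. -/
def inG2 (g : Matrix (Fin 8) (Fin 8) ℂ) : Prop :=
  SO8 g ∧ ∀ x y, g.mulVec (octMul x y) = octMul (g.mulVec x) (g.mulVec y)

/-- The compact real form `G₂`. -/
def inG2cpt (g : Matrix (Fin 8) (Fin 8) ℂ) : Prop := inG2 g ∧ realMat g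

/-- The realization `B₃(ℂ)` of `Spin(7, ℂ)`. -/
def inB3 (g : Matrix (Fin 8) (Fin 8) ℂ) : Prop :=
  SO8 g ∧ ∃ g₀, SO8 g₀ ∧ g₀.mulVec (e 0) = e 0 ∧
    ∀ x y, octMul (g₀.mulVec x) (g.mulVec y) = g.mulVec (octMul x y)

/-- The compact real form `Spin(7)`. -/
def inSpin7 (g : Matrix (Fin 8) (Fin 8) ℂ) : Prop :=
  SO8 g ∧ realMat g ∧ ∃ g₀, SO8 g₀ ∧ realMat g₀ ∧ g₀.mulVec (e 0) = e 0 ∧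
    ∀ x y, octMul (g₀.mulVec x) (g.mulVec y) = g.mulVec (octMul x y)

/-- The one-parameter group `t_θ` (abelian slice `A₁` for `(G₂(ℂ), SL(3,ℂ))`). -/
def tmat (θ : ℝ) : Matrix (Fin 8) (Fin 8) ℂ :=
  Matrix.of fun i j =>
    (![ e 0,
        (Real.cosh θ : ℂ) • e 1 + (Complex.I * (Real.sinh θ : ℂ)) • e 2,
        (-(Complex.I * (Real.sinh θ : ℂ))) • e 1 + (Real.cosh θ : ℂ) • e 2,
        e 3,
        (Real.cosh (θ/2) : ℂ) • e 4 + (-(Complex.I * (Real.sinh (θ/2) : ℂ))) • e 7,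
        (Real.cosh (θ/2) : ℂ) • e 5 + (-(Complex.I * (Real.sinh (θ/2) : ℂ))) • e 6,
        (Complex.I * (Real.sinh (θ/2) : ℂ)) • e 5 + (Real.cosh (θ/2) : ℂ) • e 6,
        (Complex.I * (Real.sinh (θ/2) : ℂ)) • e 4 + (Real.cosh (θ/2) : ℂ) • e 7 ] j) i

/-- The generator `τ₁` of the one-parameter group `A₁`, i.e. `exp (θ τ₁) = t_θ`. -/
def tau1 : Matrix (Fin 8) (Fin 8) ℂ :=
  Matrix.of fun i j =>
    (![ 0,
        Complex.I • e 2,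
        (-Complex.I) • e 1,
        0,
        (-(Complex.I/2)) • e 7,
        (-(Complex.I/2)) • e 6,
        (Complex.I/2) • e 5,
        (Complex.I/2) • e 4 ] j) i

/-- The one-parameter group `ã_θ` (abelian slice `Ã₀` for `(Spin(7,ℂ), G₂(ℂ))`). -/
def atil (θ : ℝ) : Matrix (Fin 8) (Fin 8) ℂ :=
  Matrix.of fun i j =>
    (![ (Real.cosh θ : ℂ) • e 0 + (Complex.I * (Real.sinh θ : ℂ)) • e 1,
        (-(Complex.I * (Real.sinh θ : ℂ))) • e 0 + (Real.cosh θ : ℂ) • e 1,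
        (Real.cosh (θ/3) : ℂ) • e 2 + (-(Complex.I * (Real.sinh (θ/3) : ℂ))) • e 3,
        (Complex.I * (Real.sinh (θ/3) : ℂ)) • e 2 + (Real.cosh (θ/3) : ℂ) • e 3,
        (Real.cosh (θ/3) : ℂ) • e 4 + (-(Complex.I * (Real.sinh (θ/3) : ℂ))) • e 5,
        (Complex.I * (Real.sinh (θ/3) : ℂ)) • e 4 + (Real.cosh (θ/3) : ℂ) • e 5,
        (Real.cosh (θ/3) : ℂ) • e 6 + (-(Complex.I * (Real.sinh (θ/3) : ℂ))) • e 7,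
        (Complex.I * (Real.sinh (θ/3) : ℂ)) • e 6 + (Real.cosh (θ/3) : ℂ) • e 7 ] j) i

/-- The generator `α̃₁` of the one-parameter group `Ã₀`, i.e. `exp (θ α̃₁) = ã_θ`. -/
def alphatil1 : Matrix (Fin 8) (Fin 8) ℂ :=
  Matrix.of fun i j =>
    (![ Complex.I • e 1,
        (-Complex.I) • e 0,
        (-(Complex.I/3)) • e 3,
        (Complex.I/3) • e 2,
        (-(Complex.I/3)) • e 5,
        (Complex.I/3) • e 4,
        (-(Complex.I/3)) • e 7,
        (Complex.I/3) • e 6 ] j) i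

/-- The one-parameter group `a_x` (abelian slice `A₀` for `(SO(7,ℂ), G₂(ℂ))`). -/
def amat (x : ℝ) : Matrix (Fin 8) (Fin 8) ℂ :=
  Matrix.of fun i j =>
    (![ e 0,
        e 1,
        (Real.cosh x : ℂ) • e 2 + (Complex.I * (Real.sinh x : ℂ)) • e 3,
        (-(Complex.I * (Real.sinh x : ℂ))) • e 2 + (Real.cosh x : ℂ) • e 3,
        (Real.cosh x : ℂ) • e 4 + (Complex.I * (Real.sinh x : ℂ)) • e 5,
        (-(Complex.I * (Real.sinh x : ℂ))) • e 4 + (Real.cosh x : ℂ) • e 5,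
        (Real.cosh x : ℂ) • e 6 + (Complex.I * (Real.sinh x : ℂ)) • e 7,
        (-(Complex.I * (Real.sinh x : ℂ))) • e 6 + (Real.cosh x : ℂ) • e 7 ] j) i

/-- The matrix `I₊₋ = diag(1, −1, 1, −1, 1, −1, 1, −1)`. -/
def Ipm : Matrix (Fin 8) (Fin 8) ℂ :=
  Matrix.diagonal ![1, -1, 1, -1, 1, -1, 1, -1]

/-- The anti-holomorphic involution `σ₀(g) = I₊₋ ḡ I₊₋`. -/
def sigma0 (g : Matrix (Fin 8) (Fin 8) ℂ) : Matrix (Fin 8) (Fin 8) ℂ :=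
  Ipm * g.map (starRingEnd ℂ) * Ipm

end

/-- The coordinates of a product in the complexified Cayley algebra. -/
theorem octMul_eq (x y : Fin 8 → ℂ) : octMul x y =
    ![ x 0 * y 0 - x 1 * y 1 - x 2 * y 2 - x 3 * y 3 - x 4 * y 4 - x 5 * y 5 - x 6 * y 6 - x 7 * y 7,
       x 0 * y 1 + x 1 * y 0 + x 2 * y 3 - x 3 * y 2 + x 4 * y 5 - x 5 * y 4 + x 6 * y 7 - x 7 * y 6,
       x 0 * y 2 - x 1 * y 3 + x 2 * y 0 + x 3 * y 1 - x 4 * y 6 + x 5 * y 7 + x 6 * y 4 - x 7 * y 5,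
       x 0 * y 3 + x 1 * y 2 - x 2 * y 1 + x 3 * y 0 + x 4 * y 7 + x 5 * y 6 - x 6 * y 5 - x 7 * y 4,
       x 0 * y 4 - x 1 * y 5 + x 2 * y 6 - x 3 * y 7 + x 4 * y 0 + x 5 * y 1 - x 6 * y 2 + x 7 * y 3,
       x 0 * y 5 + x 1 * y 4 - x 2 * y 7 - x 3 * y 6 - x 4 * y 1 + x 5 * y 0 + x 6 * y 3 + x 7 * y 2,
       x 0 * y 6 - x 1 * y 7 - x 2 * y 4 + x 3 * y 5 + x 4 * y 2 - x 5 * y 3 + x 6 * y 0 + x 7 * y 1,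
       x 0 * y 7 + x 1 * y 6 + x 2 * y 5 + x 3 * y 4 - x 4 * y 3 - x 5 * y 2 - x 6 * y 1 + x 7 * y 0 ] := by
  ext k
  fin_cases k <;>
    simp [octMul, octBasisMul, octLines, Fin.sum_univ_eight, e,
      List.find?] <;> ring

theorem bform_eq (x y : Fin 8 → ℂ) : bform x y =
    x 0 * y 0 + x 1 * y 1 + x 2 * y 2 + x 3 * y 3 + x 4 * y 4 + x 5 * y 5 + x 6 * y 6
      + x 7 * y 7 := by
  simp [bform, Fin.sum_univ_eight]

theorem octMul_add (x y z : Fin 8 → ℂ) : octMul x (y + z) = octMul x y + octMul x z := by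
  simp [octMul, mul_add, add_smul, Finset.sum_add_distrib]

theorem add_octMul (x y z : Fin 8 → ℂ) : octMul (x + y) z = octMul x z + octMul y z := by
  simp [octMul, add_mul, add_smul, Finset.sum_add_distrib]

theorem octMul_smul (c : ℂ) (x y : Fin 8 → ℂ) : octMul x (c • y) = c • octMul x y := by
  simp [octMul, Finset.smul_sum, smul_smul, mul_left_comm]

theorem smul_octMul (c : ℂ) (x y : Fin 8 → ℂ) : octMul (c • x) y = c • octMul x y := by
  simp [octMul, Finset.smul_sum, smul_smul, mul_assoc]

theorem one_octMul (x : Fin 8 → ℂ) : octMul (e 0) x = x := by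
  ext k
  fin_cases k <;> simp [octMul_eq, e]

theorem octMul_one (x : Fin 8 → ℂ) : octMul x (e 0) = x := by
  ext k
  fin_cases k <;> simp [octMul_eq, e]

/-- The flexible law. -/
theorem octMul_flexible (a x : Fin 8 → ℂ) :
    octMul (octMul a x) a = octMul a (octMul x a) := by
  ext k
  fin_cases k <;> simp [octMul_eq] <;> ring

theorem imag_octMul_octMul (u x : Fin 8 → ℂ) (hu : u 0 = 0) :
    octMul u (octMul u x) = (-bform u u) • x := by
  ext k
  fin_cases k <;> simp [octMul_eq, bform_eq, hu] <;> ring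

theorem octMul_octMul_imag (u x : Fin 8 → ℂ) (hu : u 0 = 0) :
    octMul (octMul x u) u = (-bform u u) • x := by
  ext k
  fin_cases k <;> simp [octMul_eq, bform_eq, hu] <;> ring

/-- The middle Moufang identity. -/
theorem octMul_moufang_middle (a x y : Fin 8 → ℂ) :
    octMul (octMul a x) (octMul y a) = octMul (octMul a (octMul x y)) a := by
  ext k
  fin_cases k <;> simp [octMul_eq] <;> ring

set_option maxHeartbeats 2000000 in
/-- The right Moufang identity. -/
theorem octMul_moufang_right (a x y : Fin 8 → ℂ) :
    octMul x (octMul (octMul a y) a) = octMul (octMul (octMul x a) y) a := by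
  ext k
  fin_cases k <;> simp [octMul_eq] <;> ring

/-- Anticommutativity of orthogonal imaginary elements. -/
theorem octMul_anticomm (x y : Fin 8 → ℂ) (hx : x 0 = 0) (hy : y 0 = 0)
    (h : bform x y = 0) : octMul y x = -octMul x y := by
  rw [bform_eq] at h
  ext k
  fin_cases k <;> simp [octMul_eq, hx, hy] at h ⊢
  · linear_combination (-2) * h
  all_goals ring

/-- The matrix of left multiplication by `a`. -/
def octL (a : Fin 8 → ℂ) : Matrix (Fin 8) (Fin 8) ℂ := Matrix.of fun i j => octMul a (e j) i

/-- The matrix of right multiplication by `a`. -/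
def octR (a : Fin 8 → ℂ) : Matrix (Fin 8) (Fin 8) ℂ := Matrix.of fun i j => octMul (e j) a i

theorem octL_mulVec (a x : Fin 8 → ℂ) : (octL a).mulVec x = octMul a x := by
  ext k
  fin_cases k <;>
    simp [octL, Matrix.mulVec, dotProduct, Fin.sum_univ_eight, octMul_eq, e, Pi.single_apply] <;>
    ring

theorem octR_mulVec (a x : Fin 8 → ℂ) : (octR a).mulVec x = octMul x a := by
  ext k
  fin_cases k <;>
    simp [octR, Matrix.mulVec, dotProduct, Fin.sum_univ_eight, octMul_eq, e, Pi.single_apply] <;>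
    ring

theorem bform_octMul_left (u x y : Fin 8 → ℂ) (hu : u 0 = 0) :
    bform (octMul u x) y = -bform x (octMul u y) := by
  simp [octMul_eq, bform_eq, hu]
  ring

theorem octL_transpose (u : Fin 8 → ℂ) (hu : u 0 = 0) : (octL u)ᵀ = -octL u := by
  ext i j
  have := bform_octMul_left u (e i) (e j) hu
  simpa [bform, e, Pi.single_apply, octL] using this

theorem bform_octMul_right (u x y : Fin 8 → ℂ) (hu : u 0 = 0) :
    bform (octMul x u) y = -bform x (octMul y u) := by
  simp [octMul_eq, bform_eq, hu]
  ring

theorem octR_transpose (u : Fin 8 → ℂ) (hu : u 0 = 0) : (octR u)ᵀ = -octR u := by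
  ext i j
  have := bform_octMul_right u (e i) (e j) hu
  simpa [bform, e, Pi.single_apply, octR] using this

theorem octL_mul_self (u : Fin 8 → ℂ) (hu : u 0 = 0) :
    octL u * octL u = (-bform u u) • 1 := by
  refine Matrix.ext_of_mulVec_single fun i => ?_
  rw [← Matrix.mulVec_mulVec, octL_mulVec, octL_mulVec, imag_octMul_octMul u _ hu,
    Matrix.smul_mulVec, Matrix.one_mulVec]

theorem octR_mul_self (u : Fin 8 → ℂ) (hu : u 0 = 0) :
    octR u * octR u = (-bform u u) • 1 := by
  refine Matrix.ext_of_mulVec_single fun i => ?_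
  rw [← Matrix.mulVec_mulVec, octR_mulVec, octR_mulVec, octMul_octMul_imag u _ hu,
    Matrix.smul_mulVec, Matrix.one_mulVec]

theorem octR_mul_octL (u : Fin 8 → ℂ) : octR u * octL u = octL u * octR u := by
  refine Matrix.ext_of_mulVec_single fun i => ?_
  rw [← Matrix.mulVec_mulVec, ← Matrix.mulVec_mulVec, octR_mulVec, octL_mulVec, octL_mulVec,
    octR_mulVec, octMul_flexible]

/-- For imaginary `u` with `(u, u) = 3`, conjugation by `1 + u`, whose inverse is `(1 - u) / 4`. -/
noncomputable def octConj (u : Fin 8 → ℂ) : Matrix (Fin 8) (Fin 8) ℂ :=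
  (1 / 4 : ℂ) • ((1 + octL u) * (1 - octR u))

theorem SO8_octConj (u : Fin 8 → ℂ) (hu : u 0 = 0) (h : bform u u = 3) : SO8 (octConj u) := by
  have hU := octL_mul_self u hu
  have hV := octR_mul_self u hu
  have hc : Commute (octL u) (octR u) := (octR_mul_octL u).symm
  rw [h] at hU hV
  have hU1 : (1 - octL u) * (1 + octL u) = (4 : ℂ) • 1 := by
    have : (1 - octL u) * (1 + octL u) = 1 - octL u * octL u := by noncomm_ring
    rw [this, hU]; module
  have hV1 : (1 + octR u) * (1 - octR u) = (4 : ℂ) • 1 := by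
    have : (1 + octR u) * (1 - octR u) = 1 - octR u * octR u := by noncomm_ring
    rw [this, hV]; module
  have hU3 : (1 + octL u) ^ 3 = (-8 : ℂ) • 1 := by
    have : (1 + octL u) ^ 3 = 1 + (3 : ℂ) • octL u + (3 : ℂ) • (octL u * octL u)
        + octL u * octL u * octL u := by
      simp only [show (3 : ℂ) = ((3 : ℕ) : ℂ) by norm_num, Nat.cast_smul_eq_nsmul]
      noncomm_ring
    rw [this, hU, smul_mul_assoc, one_mul]; module
  have hV3 : (1 - octR u) ^ 3 = (-8 : ℂ) • 1 := by
    have : (1 - octR u) ^ 3 = 1 - (3 : ℂ) • octR u + (3 : ℂ) • (octR u * octR u)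
        - octR u * octR u * octR u := by
      simp only [show (3 : ℂ) = ((3 : ℕ) : ℂ) by norm_num, Nat.cast_smul_eq_nsmul]
      noncomm_ring
    rw [this, hV, smul_mul_assoc, one_mul]; module
  have horth : (octConj u)ᵀ * octConj u = 1 := by
    have ht : (octConj u)ᵀ = (1 / 4 : ℂ) • ((1 + octR u) * (1 - octL u)) := by
      simp [octConj, octL_transpose u hu, octR_transpose u hu, sub_eq_add_neg]
    rw [ht, octConj, smul_mul_smul_comm, mul_assoc, ← mul_assoc (1 - octL u), hU1, smul_mul_assoc,
      one_mul, mul_smul_comm, hV1, smul_smul, smul_smul]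
    norm_num
  refine ⟨horth, ?_⟩
  have hcube : octConj u ^ 3 = 1 := by
    have hc' : Commute (1 + octL u) (1 - octR u) :=
      ((Commute.one_left _).add_left ((Commute.one_right _).sub_right hc))
    rw [octConj, smul_pow, hc'.mul_pow, hU3, hV3, smul_mul_smul_comm, one_mul, smul_smul]
    norm_num
  have h3 : (octConj u).det ^ 3 = 1 := by rw [← Matrix.det_pow, hcube, Matrix.det_one]
  have h2 : (octConj u).det * (octConj u).det = 1 := by
    have := congrArg Matrix.det horth
    rwa [Matrix.det_mul, Matrix.det_transpose, Matrix.det_one] at this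
  linear_combination h3 - (octConj u).det * h2

theorem octConj_mulVec (u x : Fin 8 → ℂ) :
    (octConj u).mulVec x = (1 / 4 : ℂ) • octMul (e 0 + u) (octMul x (e 0 - u)) := by
  rw [octConj, Matrix.smul_mulVec, ← Matrix.mulVec_mulVec, Matrix.sub_mulVec, Matrix.add_mulVec,
    Matrix.one_mulVec, Matrix.one_mulVec, octR_mulVec, octL_mulVec, sub_eq_add_neg (e 0) u,
    ← neg_one_smul ℂ u, octMul_add x, octMul_smul, octMul_one, add_octMul, one_octMul,
    neg_one_smul, ← sub_eq_add_neg]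

theorem octMul_one_sub_one_add (u x : Fin 8 → ℂ) (hu : u 0 = 0) (h : bform u u = 3) :
    octMul (octMul x (e 0 - u)) (e 0 + u) = (4 : ℂ) • x := by
  have := octMul_octMul_imag u x hu
  rw [h] at this
  rw [sub_eq_add_neg (e 0) u, ← neg_one_smul ℂ u]
  simp only [octMul_add, add_octMul, octMul_smul, smul_octMul, octMul_one, this]
  module

theorem octMul_one_add_one_add (u x : Fin 8 → ℂ) (hu : u 0 = 0) (h : bform u u = 3) :
    octMul (octMul x (e 0 + u)) (e 0 + u) = (-2 : ℂ) • octMul x (e 0 - u) := by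
  have := octMul_octMul_imag u x hu
  rw [h] at this
  rw [sub_eq_add_neg (e 0) u, ← neg_one_smul ℂ u]
  simp only [octMul_add, add_octMul, octMul_smul, octMul_one, this]
  module

theorem octMul_one_add_one_sub (u x : Fin 8 → ℂ) :
    octMul (octMul (e 0 + u) x) (e 0 - u) = octMul (e 0 + u) (octMul x (e 0 - u)) := by
  have := octMul_flexible u x
  rw [sub_eq_add_neg (e 0) u, ← neg_one_smul ℂ u]
  simp only [octMul_add, add_octMul, octMul_smul, octMul_one, one_octMul, this]

theorem octConj_octMul (u : Fin 8 → ℂ) (hu : u 0 = 0) (h : bform u u = 3) (x y : Fin 8 → ℂ) :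
    (octConj u).mulVec (octMul x y) =
      octMul ((octConj u).mulVec x) ((octConj u).mulVec y) := by
  have key : ∀ z, (octConj u).mulVec z =
      (-1 / 8 : ℂ) • octMul (octMul (octMul (e 0 + u) z) (e 0 + u)) (e 0 + u) := fun z => by
    rw [octMul_one_add_one_add u _ hu h, octConj_mulVec, octMul_one_add_one_sub, smul_smul]
    norm_num
  rw [key y, key (octMul x y), octConj_mulVec u x, octMul_smul, smul_octMul,
    octMul_moufang_middle, octMul_moufang_right, octMul_one_sub_one_add u x hu h,
    smul_octMul, smul_octMul, octMul_smul, smul_octMul, smul_smul, smul_smul, ← octMul_flexible]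
  norm_num

theorem inG2_octConj (u : Fin 8 → ℂ) (hu : u 0 = 0) (h : bform u u = 3) : inG2 (octConj u) :=
  ⟨SO8_octConj u hu h, octConj_octMul u hu h⟩

theorem inG2_mul {g h : Matrix (Fin 8) (Fin 8) ℂ} (hg : inG2 g) (hh : inG2 h) :
    inG2 (g * h) := by
  obtain ⟨⟨hg1, hg2⟩, hg3⟩ := hg
  obtain ⟨⟨hh1, hh2⟩, hh3⟩ := hh
  refine ⟨⟨?_, by rw [Matrix.det_mul, hg2, hh2, one_mul]⟩, fun x y => ?_⟩
  · rw [Matrix.transpose_mul, mul_assoc, ← mul_assoc gᵀ, hg1, one_mul, hh1]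
  · simp only [← Matrix.mulVec_mulVec, hg3, hh3]

/-- Multiplicativity of the norm of the Cayley algebra. -/
theorem bform_octMul_self (x y : Fin 8 → ℂ) :
    bform (octMul x y) (octMul x y) = bform x x * bform y y := by
  simp [octMul_eq, bform_eq]
  ring

/-- If `x` and `y` are imaginary and orthonormal, some element of `G₂(ℂ)` moves `x` to `y`. -/
theorem exists_inG2_of_orthonormal (x y : Fin 8 → ℂ) (hx : x 0 = 0) (hy : y 0 = 0)
    (hxx : bform x x = 1) (hyy : bform y y = 1) (hxy : bform x y = 0) :
    ∃ g : Matrix (Fin 8) (Fin 8) ℂ, inG2 g ∧ g.mulVec x = y := by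
  have hu : (x + y + octMul x y) 0 = 0 := by
    rw [bform_eq] at hxy
    simp [octMul_eq, hx, hy] at hxy ⊢
    linear_combination -hxy
  have hanti := octMul_anticomm x y hx hy hxy
  have h1 : bform x (octMul x y) = 0 := by
    have : bform x (octMul x y) = bform x x * y 0 := by simp [octMul_eq, bform_eq]; ring
    rw [this, hy, mul_zero]
  have h2 : bform y (octMul x y) = 0 := by
    have : bform y (octMul x y) = bform y y * x 0 := by simp [octMul_eq, bform_eq]; ring
    rw [this, hx, mul_zero]
  have h3 : bform (x + y + octMul x y) (x + y + octMul x y) = 3 := by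
    have h4 := bform_octMul_self x y
    have expand : ∀ z : Fin 8 → ℂ, bform (x + y + z) (x + y + z) = bform x x + bform y y
        + bform z z + 2 * bform x y + 2 * bform x z + 2 * bform y z := fun z => by
      simp only [bform_eq, Pi.add_apply]; ring
    rw [expand, h4, hxx, hyy, hxy, h1, h2]
    norm_num
  refine ⟨octConj (x + y + octMul x y), inG2_octConj _ hu h3, ?_⟩
  have hyxx : octMul (octMul x y) x = y := by
    have := octMul_octMul_imag x y hx
    rw [hanti, ← neg_one_smul ℂ (octMul x y), smul_octMul, hxx] at this
    simpa using this
  have hyyx : octMul y (octMul x y) = x := by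
    have := imag_octMul_octMul y x hy
    rw [hanti, ← neg_one_smul ℂ (octMul x y), octMul_smul, hyy] at this
    simpa using this
  have hxsq : octMul x x = -e 0 := by
    have := imag_octMul_octMul x (e 0) hx
    rwa [octMul_one, hxx, neg_one_smul] at this
  have hysq : octMul y y = -e 0 := by
    have := imag_octMul_octMul y (e 0) hy
    rwa [octMul_one, hyy, neg_one_smul] at this
  have hcomm : octMul (e 0 + (x + y + octMul x y)) x =
      octMul y (e 0 + (x + y + octMul x y)) := by
    simp only [octMul_add, add_octMul, octMul_one, one_octMul, hyxx, hyyx, hanti, hxsq, hysq]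
    abel
  have h4 : octMul (octMul y (e 0 + (x + y + octMul x y))) (e 0 - (x + y + octMul x y)) =
      (4 : ℂ) • y := by
    have h5 : bform (-(x + y + octMul x y)) (-(x + y + octMul x y)) = 3 := by
      rw [← h3]; simp only [bform, Pi.neg_apply, neg_mul_neg]
    have := octMul_one_sub_one_add (-(x + y + octMul x y)) y (by rw [Pi.neg_apply, hu, neg_zero]) h5
    rwa [sub_neg_eq_add, ← sub_eq_add_neg] at this
  rw [octConj_mulVec, ← octMul_one_add_one_sub, hcomm, h4, smul_smul]
  norm_num

/-- Some imaginary unit vector is orthogonal to both `e₁` and `v`. -/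
theorem exists_unit_orthogonal (v : Fin 8 → ℂ) :
    ∃ w : Fin 8 → ℂ, w 0 = 0 ∧ bform w w = 1 ∧ bform (e 1) w = 0 ∧ bform w v = 0 := by
  have pair : ∀ i j : Fin 8, i ≠ j → i ≠ 0 → i ≠ 1 → j ≠ 0 → j ≠ 1 →
      v i ^ 2 + v j ^ 2 ≠ 0 →
      ∃ w : Fin 8 → ℂ, w 0 = 0 ∧ bform w w = 1 ∧ bform (e 1) w = 0 ∧ bform w v = 0 := by
    intro i j hij hi0 hi1 hj0 hj1 hne
    obtain ⟨s, hs⟩ := IsAlgClosed.exists_pow_nat_eq (v i ^ 2 + v j ^ 2) (n := 2) (by norm_num)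
    have hs0 : s ≠ 0 := by rintro rfl; exact hne (by rw [← hs]; norm_num)
    have hw : ∀ z, bform (s⁻¹ • (v j • e i - v i • e j)) z = s⁻¹ * (v j * z i - v i * z j) :=
      fun z => by
        simp [bform, e, Pi.single_apply, sub_mul, mul_assoc, mul_sub, Finset.sum_sub_distrib]
    refine ⟨s⁻¹ • (v j • e i - v i • e j), ?_, ?_, ?_, ?_⟩
    · simp [e, hi0.symm, hj0.symm]
    · rw [hw]
      simp only [e, Pi.smul_apply, Pi.sub_apply, smul_eq_mul, Pi.single_eq_same,
        Pi.single_eq_of_ne hij, Pi.single_eq_of_ne hij.symm]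
      field_simp
      linear_combination -hs
    · simp [bform, e, Pi.single_apply, hi1.symm, hj1.symm]
    · rw [hw]
      ring
  by_cases h23 : v 2 ^ 2 + v 3 ^ 2 = 0
  · by_cases h24 : v 2 ^ 2 + v 4 ^ 2 = 0
    · by_cases h34 : v 3 ^ 2 + v 4 ^ 2 = 0
      · have h2 : v 2 = 0 := by
          have : v 2 ^ 2 = 0 := by linear_combination (h23 + h24 - h34) / 2
          simpa using this
        exact ⟨e 2, by simp [e], by simp [bform_eq, e], by simp [bform_eq, e],
          by simp [bform_eq, e, h2]⟩
      · exact pair 3 4 (by decide) (by decide) (by decide) (by decide) (by decide) h34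
    · exact pair 2 4 (by decide) (by decide) (by decide) (by decide) (by decide) h24
  · exact pair 2 3 (by decide) (by decide) (by decide) (by decide) (by decide) h23

/-- The group `G₂(ℂ)` acts transitively on the complex unit sphere `S_ℂ^6` of the
imaginary part of `𝕆_ℂ`: every `v` in the ℂ-span of `e₁, …, e₇` with `(v, v) = 1` is of
the form `g e₁` for some `g ∈ G₂(ℂ)`.  Hence `S_ℂ^6` is identified with the
non-symmetric homogeneous space `G₂(ℂ)/SL(3,ℂ)`, where `SL(3,ℂ)` is realized as the
stabilizer of `e₁` in `G₂(ℂ)`. -/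
theorem stmt5 (v : Fin 8 → ℂ) (hv0 : v 0 = 0) (hv : bform v v = 1) :
    ∃ g : Matrix (Fin 8) (Fin 8) ℂ, inG2 g ∧ g.mulVec (e 1) = v := by
  obtain ⟨w, hw0, hww, h1w, hwv⟩ := exists_unit_orthogonal v
  obtain ⟨g, hg, hgw⟩ := exists_inG2_of_orthonormal (e 1) w (by simp [e]) hw0
    (by simp [bform_eq, e]) hww h1w
  obtain ⟨h, hh, hhv⟩ := exists_inG2_of_orthonormal w v hw0 hv0 hww hv hwv
  exact ⟨h * g, inG2_mul hh hg, by rw [← Matrix.mulVec_mulVec, hgw, hhv]⟩
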